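/- arXiv:1801.06654 — 9 statements merged into one kernel-verified Lean document; each statement's English description precedes it below -/
import Mathlib

section
/- Let A be a rigorously compact commutative residuated lattice with least element ⊥ and greatest element ⊤, let B be a commutative residuated lattice, and let h : A → B be a homomorphism that is not a constant function. Then for every a ∈ A, h(a) = h(⊥) implies a = ⊥, and h(a) = h(⊤) implies a = ⊤. -/
/-- A commutative residuated lattice (RL): a commutative monoid and a lattice
satisfying the law of residuation `x·y ≤ z ↔ y ≤ x → z`. -/
class CRL (α : Type*) extends Lattice α, CommMonoid α where
  resid : α → α → α
  residuation : ∀ x y z : α, x * y ≤ z ↔ y ≤ resid x z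

theorem CRL.mul_bot {A : Type*} [CRL A] [OrderBot A] (x : A) : x * ⊥ = ⊥ :=
  le_bot_iff.mp ((CRL.residuation x ⊥ ⊥).mpr bot_le)

theorem CRL.resid_top {A : Type*} [CRL A] [OrderTop A] (x : A) : CRL.resid x ⊤ = ⊤ :=
  top_le_iff.mp ((CRL.residuation x ⊤ ⊤).mp le_top)

theorem CRL.mul_resid_le {A : Type*} [CRL A] (x y : A) : x * CRL.resid x y ≤ y :=
  (CRL.residuation x _ y).mpr le_rfl

/-- If `A` is a rigorously compact commutative residuated lattice
(with least element `⊥` and greatest element `⊤`, and `⊤·a = ⊤` for `a ≠ ⊥`),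
`B` is a commutative residuated lattice, and `h : A → B` is a non-constant
homomorphism, then the `h`-preimage of `h ⊥` is `{⊥}` and that of `h ⊤` is `{⊤}`. -/
theorem stmt0 {A B : Type*} [CRL A] [CRL B] [OrderBot A] [OrderTop A]
    (hrig : ∀ a : A, a ≠ ⊥ → (⊤ : A) * a = ⊤)
    (h : A → B)
    (hmul : ∀ x y : A, h (x * y) = h x * h y)
    (hres : ∀ x y : A, h (CRL.resid x y) = CRL.resid (h x) (h y))
    (hinf : ∀ x y : A, h (x ⊓ y) = h x ⊓ h y)
    (hsup : ∀ x y : A, h (x ⊔ y) = h x ⊔ h y)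
    (hone : h 1 = 1)
    (hnotconst : ∃ x y : A, h x ≠ h y) :
    ∀ a : A, (h a = h ⊥ → a = ⊥) ∧ (h a = h ⊤ → a = ⊤) := by
  have hmono : Monotone h := fun x y hxy => by
    rw [← sup_eq_right, ← hsup, sup_eq_right.mpr hxy]
  have hne : h ⊥ ≠ h ⊤ := by
    intro heq
    have hbot : ∀ x, h x = h ⊥ := fun x =>
      le_antisymm ((hmono le_top).trans heq.ge) (hmono bot_le)
    obtain ⟨x, y, hxy⟩ := hnotconst
    exact hxy ((hbot x).trans (hbot y).symm)
  intro a
  constructor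
  · intro ha
    by_contra hbot
    apply hne
    rw [← hrig a hbot, hmul, ha, ← hmul, CRL.mul_bot]
  · intro ha
    by_contra htop
    have hr : CRL.resid ⊤ a = ⊥ := by
      by_contra hr
      exact htop (top_le_iff.mp ((hrig _ hr).ge.trans (CRL.mul_resid_le ⊤ a)))
    apply hne
    rw [← hr, hres, ha, ← hres, CRL.resid_top]
end

section
/- Let A be a rigorously compact commutative residuated lattice with least element ⊥ and greatest element ⊤, let B be a commutative residuated lattice whose lattice order is total, and let h : A → B be a homomorphism that is not a constant function. Then ⊥ is meet-irreducible in A (if ⊥ = a ∧ b then a = ⊥ or b = ⊥) and ⊤ is join-irreducible in A (if ⊤ = a ∨ b then a = ⊤ or b = ⊤). -/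
theorem CRL.top_mul_bot {A : Type*} [CRL A] [OrderBot A] [OrderTop A] :
    (⊤ : A) * ⊥ = ⊥ :=
  le_bot_iff.mp ((CRL.residuation _ _ _).mpr bot_le)

theorem CRL.resid_top_top {A : Type*} [CRL A] [OrderTop A] :
    CRL.resid (⊤ : A) ⊤ = ⊤ :=
  top_le_iff.mp ((CRL.residuation _ _ _).mp le_top)

/-- In a rigorously compact CRL, `⊤ → a = ⊥` whenever `a ≠ ⊤`. -/
theorem CRL.resid_top_eq_bot {A : Type*} [CRL A] [OrderBot A] [OrderTop A]
    (hrig : ∀ a : A, a ≠ ⊥ → (⊤ : A) * a = ⊤) {a : A} (ha : a ≠ ⊤) :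
    CRL.resid ⊤ a = ⊥ := by
  by_contra hc
  have hle : ⊤ * CRL.resid ⊤ a ≤ a := (CRL.residuation _ _ _).mpr le_rfl
  rw [hrig _ hc] at hle
  exact ha (top_le_iff.mp hle)

/-- If `A` is a rigorously compact commutative residuated lattice,
`B` is a commutative residuated lattice whose lattice order is total, and
`h : A → B` is a non-constant homomorphism, then `⊥` is meet-irreducible and `⊤`
is join-irreducible in `A`. -/
theorem stmt1 {A B : Type*} [CRL A] [CRL B] [OrderBot A] [OrderTop A]
    (hrig : ∀ a : A, a ≠ ⊥ → (⊤ : A) * a = ⊤)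
    (htotal : ∀ x y : B, x ≤ y ∨ y ≤ x)
    (h : A → B)
    (hmul : ∀ x y : A, h (x * y) = h x * h y)
    (hres : ∀ x y : A, h (CRL.resid x y) = CRL.resid (h x) (h y))
    (hinf : ∀ x y : A, h (x ⊓ y) = h x ⊓ h y)
    (hsup : ∀ x y : A, h (x ⊔ y) = h x ⊔ h y)
    (hone : h 1 = 1)
    (hnotconst : ∃ x y : A, h x ≠ h y) :
    (∀ a b : A, (⊥ : A) = a ⊓ b → a = ⊥ ∨ b = ⊥) ∧
    (∀ a b : A, (⊤ : A) = a ⊔ b → a = ⊤ ∨ b = ⊤) := by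
  have hmono : Monotone h := fun x y hxy => by
    rw [← inf_eq_left.mpr hxy, hinf]
    exact inf_le_right
  have hne : h ⊥ ≠ h ⊤ := by
    intro heq
    obtain ⟨x, y, hxy⟩ := hnotconst
    have hconst (z : A) : h z = h ⊥ :=
      le_antisymm ((hmono le_top).trans heq.ge) (hmono bot_le)
    exact hxy ((hconst x).trans (hconst y).symm)
  have hbot (a : A) (ha : h a = h ⊥) : a = ⊥ := by
    by_contra hc
    apply hne
    rw [← hrig a hc, hmul, ha, ← hmul, CRL.top_mul_bot]
  have htop (a : A) (ha : h a = h ⊤) : a = ⊤ := by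
    by_contra hc
    apply hne
    rw [← CRL.resid_top_eq_bot hrig hc, hres, ha, ← hres, CRL.resid_top_top]
  refine ⟨fun a b hab => ?_, fun a b hab => ?_⟩
  · have hh : h ⊥ = h a ⊓ h b := by rw [hab, hinf]
    rcases htotal (h a) (h b) with hle | hle
    · exact Or.inl (hbot a (by rw [hh, inf_eq_left.mpr hle]))
    · exact Or.inr (hbot b (by rw [hh, inf_eq_right.mpr hle]))
  · have hh : h ⊤ = h a ⊔ h b := by rw [hab, hsup]
    rcases htotal (h a) (h b) with hle | hle
    · exact Or.inr (htop b (by rw [hh, sup_eq_right.mpr hle]))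
    · exact Or.inl (htop a (by rw [hh, sup_eq_left.mpr hle]))
end

section
/- Let A be a square-increasing IRL satisfying x ≤ f·f for all x (A is anti-idempotent), and suppose e has exactly one strict lower bound (so that A is simple). Then for every a ∈ A with e < a, one has a·f = f·f. -/
/-- An involutive (commutative) residuated lattice (IRL). -/
class IRL (α : Type*) extends Lattice α, CommMonoid α where
  neg : α → α
  neg_neg : ∀ x : α, neg (neg x) = x
  resid_law : ∀ x y z : α, x * y ≤ z ↔ neg z * y ≤ neg x

namespace IRL

variable {α : Type*} [IRL α]

/-- `f := ¬e`. -/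
def f : α := neg 1

/-- `x → y := ¬(x · ¬y)`. -/
def arrow (x y : α) : α := neg (x * neg y)

/-- `q(x) := (f·f) → (¬x · ¬x)`. -/
def qq (x : α) : α := arrow (f * f) (neg x * neg x)

end IRL

namespace IRL

variable {α : Type*} [IRL α]

theorem neg_le_neg_iff (x y : α) : neg y ≤ neg x ↔ x ≤ y := by
  simpa using (resid_law x 1 y).symm

theorem neg_f : neg (f : α) = 1 := neg_neg 1

theorem mul_le_mul_of_le {x x' : α} (h : x ≤ x') (y : α) : x * y ≤ x' * y :=
  (resid_law x y _).2 <|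
    ((resid_law x' y _).1 le_rfl).trans ((neg_le_neg_iff x x').2 h)

theorem neg_mul_f_mul_le_one (a : α) : neg (a * f) * a ≤ 1 := by
  have h : (f : α) * a ≤ a * f := (mul_comm _ _).le
  simpa only [neg_f] using (resid_law _ _ _).1 h

theorem neg_mul_f_le_one {a : α} (ha : 1 ≤ a) : neg (a * f) ≤ 1 := by
  rw [← neg_f, neg_le_neg_iff]
  simpa using mul_le_mul_of_le ha f

theorem neg_mul_f_lt_one {a : α} (ha : 1 < a) : neg (a * f) < 1 := by
  refine lt_of_le_of_ne (neg_mul_f_le_one ha.le) fun h => ha.not_ge ?_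
  simpa [h] using neg_mul_f_mul_le_one a

theorem neg_le_of_forall_le {t : α} (ht : ∀ x : α, x ≤ t) (x : α) : neg t ≤ x := by
  rw [← neg_neg x, neg_le_neg_iff]
  exact ht _

end IRL

/-- In a simple anti-idempotent square-increasing IRL (`e` has
exactly one strict lower bound, and `x ≤ f·f` for all `x`), every `a > e`
satisfies `a·f = f·f`. -/
theorem stmt2 {A : Type*} [IRL A]
    (sq : ∀ x : A, x ≤ x * x)
    (anti : ∀ x : A, x ≤ (IRL.f : A) * IRL.f)
    (hsimple : ∃! x : A, x < 1) :
    ∀ a : A, 1 < a → a * IRL.f = (IRL.f : A) * IRL.f := by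
  intro a ha
  obtain ⟨x, hx, huniq⟩ := hsimple
  have hbot : IRL.neg ((IRL.f : A) * IRL.f) < 1 :=
    (IRL.neg_le_of_forall_le anti x).trans_lt hx
  have heq := (huniq _ (IRL.neg_mul_f_lt_one ha)).trans (huniq _ hbot).symm
  rw [← IRL.neg_neg (a * IRL.f), heq, IRL.neg_neg]
end

section
/- Let A be a square-increasing IRL such that ¬(f·f) < e and every x ∈ A with x < e equals ¬(f·f) (i.e., A is simple with unique strict lower bound ¬(f·f) of e, as happens when the four-element De Morgan monoid C4 or D4 is a subalgebra of a simple A). Then x ≤ f·f for all x ∈ A, i.e., A is anti-idempotent. -/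
theorem IRL.neg_le_neg {α : Type*} [IRL α] {x y : α} (h : x ≤ y) : IRL.neg y ≤ IRL.neg x := by
  simpa only [mul_one] using (IRL.resid_law x 1 y).1 (by simpa only [mul_one] using h)

/-- Let `A` be a square-increasing IRL in which `¬(f·f) < e` and
every `x < e` equals `¬(f·f)`.  Then `x ≤ f·f` for all `x`, i.e. `A` is
anti-idempotent. -/
theorem stmt3 {A : Type*} [IRL A]
    (sq : ∀ x : A, x ≤ x * x)
    (hlt : IRL.neg ((IRL.f : A) * IRL.f) < 1)
    (honly : ∀ x : A, x < 1 → x = IRL.neg ((IRL.f : A) * IRL.f)) :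
    ∀ x : A, x ≤ (IRL.f : A) * IRL.f := by
  intro x
  have hbot : IRL.neg ((IRL.f : A) * IRL.f) ≤ IRL.neg x :=
    inf_eq_left.1 (honly _ (inf_le_left.trans_lt hlt))
  simpa only [IRL.neg_neg] using IRL.neg_le_neg hbot
end

section
/- Let L be a modular lattice with least element ⊥ and greatest element ⊤, and let B, B' ⊆ L be such that every element of L lies in exactly one of B, B', {⊥}, {⊤}; B and B' are closed under ∧ and ∨ and satisfy the distributive law internally (for all x, y, z ∈ B, x ∧ (y ∨ z) = (x ∧ y) ∨ (x ∧ z), and likewise for B'); and for all b ∈ B and c ∈ B', b ∧ c ∈ B and b ∨ c ∈ B'. Then L is a distributive lattice. -/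
section ModularLattice

variable {L : Type*} [Lattice L] [IsModularLattice L]

/-- Two atoms of the copy of `M₃` generated by `x, y, z` in a modular lattice, where `e` is the upper
median, meet in the lower median; the identity holds for every `e`. -/
theorem inf_sup_inf_inf_sup_of_eq_lowerMedian {x y z d e : L} (hd : d = x ⊓ y ⊔ y ⊓ z ⊔ z ⊓ x) :
    (x ⊓ e ⊔ d) ⊓ (y ⊓ e ⊔ d) = d := by
  have hxy : x ⊓ y ≤ d := hd ▸ le_sup_left.trans le_sup_left
  have hzx : z ⊓ x ≤ d := hd ▸ le_sup_right
  have hyd : y ⊓ e ⊔ d ≤ z ⊓ x ⊔ y := by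
    rw [hd]
    refine sup_le (inf_le_left.trans le_sup_right) (sup_le (sup_le ?_ ?_) le_sup_left)
    · exact inf_le_right.trans le_sup_right
    · exact inf_le_left.trans le_sup_right
  refine le_antisymm ?_ (le_inf le_sup_right le_sup_right)
  rw [sup_comm (x ⊓ e), sup_inf_assoc_of_le (x ⊓ e) (le_sup_right : d ≤ y ⊓ e ⊔ d)]
  refine sup_le le_rfl ?_
  calc x ⊓ e ⊓ (y ⊓ e ⊔ d) ≤ (z ⊓ x ⊔ y) ⊓ x :=
        le_inf (inf_le_right.trans hyd) (inf_le_left.trans inf_le_left)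
    _ = z ⊓ x ⊔ y ⊓ x := sup_inf_assoc_of_le y inf_le_right
    _ ≤ d := sup_le hzx (inf_comm y x ▸ hxy)

/-- Two atoms of the copy of `M₃` generated by `x, y, z` in a modular lattice, where `d` is the lower
median, join to the upper median; the identity holds for every `d ≤ e`. -/
theorem inf_sup_sup_inf_sup_of_eq_upperMedian {x y z d e : L}
    (he : e = (x ⊔ y) ⊓ (y ⊔ z) ⊓ (z ⊔ x)) (hde : d ≤ e) :
    (x ⊓ e ⊔ d) ⊔ (y ⊓ e ⊔ d) = e := by
  have h : (x ⊔ d) ⊓ e ⊔ (y ⊔ d) ⊓ e = e :=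
    inf_sup_inf_inf_sup_of_eq_lowerMedian (L := Lᵒᵈ) he
  rw [inf_comm x, inf_comm y, inf_sup_assoc_of_le x hde, inf_sup_assoc_of_le y hde,
    inf_comm e, inf_comm e]
  exact h

/-- A modular lattice without a sublattice isomorphic to `M₃` is distributive. -/
theorem inf_sup_left_of_no_diamond
    (h : ∀ p q r o i : L, p ⊓ q = o → q ⊓ r = o → r ⊓ p = o →
      p ⊔ q = i → q ⊔ r = i → r ⊔ p = i → o = i) (x y z : L) :
    x ⊓ (y ⊔ z) = (x ⊓ y) ⊔ (x ⊓ z) := by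
  obtain ⟨d, hd⟩ : ∃ d, d = x ⊓ y ⊔ y ⊓ z ⊔ z ⊓ x := ⟨_, rfl⟩
  obtain ⟨e, he⟩ : ∃ e, e = (x ⊔ y) ⊓ (y ⊔ z) ⊓ (z ⊔ x) := ⟨_, rfl⟩
  have hd₁ : d = y ⊓ z ⊔ z ⊓ x ⊔ x ⊓ y := by rw [hd]; ac_rfl
  have hd₂ : d = z ⊓ x ⊔ x ⊓ y ⊔ y ⊓ z := by rw [hd]; ac_rfl
  have he₁ : e = (y ⊔ z) ⊓ (z ⊔ x) ⊓ (x ⊔ y) := by rw [he]; ac_rfl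
  have he₂ : e = (z ⊔ x) ⊓ (x ⊔ y) ⊓ (y ⊔ z) := by rw [he]; ac_rfl
  have hde : d ≤ e := by
    rw [hd, he]
    refine sup_le (sup_le ?_ ?_) ?_ <;> refine le_inf (le_inf ?_ ?_) ?_ <;>
      first
        | exact inf_le_left.trans le_sup_left
        | exact inf_le_left.trans le_sup_right
        | exact inf_le_right.trans le_sup_left
  have heq : d = e := h _ _ _ d e
    (inf_sup_inf_inf_sup_of_eq_lowerMedian hd) (inf_sup_inf_inf_sup_of_eq_lowerMedian hd₁)
    (inf_sup_inf_inf_sup_of_eq_lowerMedian hd₂) (inf_sup_sup_inf_sup_of_eq_upperMedian he hde)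
    (inf_sup_sup_inf_sup_of_eq_upperMedian he₁ hde) (inf_sup_sup_inf_sup_of_eq_upperMedian he₂ hde)
  refine le_antisymm ?_ le_inf_sup
  calc x ⊓ (y ⊔ z) ≤ e ⊓ x := by
        rw [he]
        exact le_inf (le_inf (le_inf (inf_le_left.trans le_sup_left) inf_le_right)
          (inf_le_left.trans le_sup_right)) inf_le_left
    _ = ((x ⊓ y ⊔ z ⊓ x) ⊔ y ⊓ z) ⊓ x := by rw [← heq, hd, sup_right_comm]
    _ = (x ⊓ y ⊔ z ⊓ x) ⊔ y ⊓ z ⊓ x :=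
        sup_inf_assoc_of_le _ (sup_le inf_le_left inf_le_right)
    _ ≤ (x ⊓ y) ⊔ (x ⊓ z) := by
        rw [inf_comm z x]
        exact sup_le le_rfl (le_sup_of_le_left (le_inf inf_le_right
          (inf_le_left.trans inf_le_left)))

end ModularLattice

/-- The bottom of a diamond equals its top as soon as one of its atoms lies below the other two. -/
theorem diamond_trivial_of_le {L : Type*} [Lattice L] {p q r o i : L} (hqr : q ⊓ r = o)
    (hpq : p ⊔ q = i) (hrp : r ⊔ p = i) (h₁ : p ≤ q) (h₂ : p ≤ r) : o = i := by
  rw [sup_eq_right.2 h₁] at hpq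
  rw [sup_eq_left.2 h₂] at hrp
  rw [← hqr, hpq, hrp, inf_idem]

/-- The bottom of a diamond equals its top as soon as one of its atoms lies above the other two. -/
theorem diamond_trivial_of_ge {L : Type*} [Lattice L] {p q r o i : L} (hqr : q ⊔ r = i)
    (hpq : p ⊓ q = o) (hrp : r ⊓ p = o) (h₁ : q ≤ p) (h₂ : r ≤ p) : o = i :=
  (diamond_trivial_of_le (L := Lᵒᵈ) hqr hpq hrp h₁ h₂).symm

/-- The bottom of a diamond equals its top as soon as its atoms satisfy the distributive law. -/
theorem diamond_trivial_of_distrib {L : Type*} [Lattice L] {p q r o i : L} (hpq : p ⊓ q = o)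
    (hqr : q ⊓ r = o) (hrp : r ⊓ p = o) (jpq : p ⊔ q = i) (jqr : q ⊔ r = i) (jrp : r ⊔ p = i)
    (h : p ⊓ (q ⊔ r) = (p ⊓ q) ⊔ (p ⊓ r)) : o = i := by
  have hp : p = o := by
    rwa [inf_comm p r, hpq, hrp, sup_idem, jqr, ← jpq, inf_sup_self] at h
  exact diamond_trivial_of_le hqr jpq jrp (inf_eq_left.1 (hpq.trans hp.symm))
    (inf_eq_right.1 (hrp.trans hp.symm))

/-- A bounded modular lattice partitioned as
`B ∪ B' ∪ {⊥} ∪ {⊤}`, where `B` and `B'` are internally distributive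
sublattices, and `b ∧ c ∈ B`, `b ∨ c ∈ B'` for `b ∈ B`, `c ∈ B'`, is
distributive. -/
theorem stmt11 {L : Type*} [Lattice L] [IsModularLattice L] [OrderBot L] [OrderTop L]
    (B B' : Set L)
    (hcover : ∀ a : L, a ∈ B ∨ a ∈ B' ∨ a = ⊥ ∨ a = ⊤)
    (hdisj1 : ∀ a ∈ B, a ∉ B' ∧ a ≠ ⊥ ∧ a ≠ ⊤)
    (hdisj2 : ∀ a ∈ B', a ≠ ⊥ ∧ a ≠ ⊤)
    (hbt : (⊥ : L) ≠ ⊤)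
    (hBinf : ∀ x ∈ B, ∀ y ∈ B, x ⊓ y ∈ B)
    (hBsup : ∀ x ∈ B, ∀ y ∈ B, x ⊔ y ∈ B)
    (hB'inf : ∀ x ∈ B', ∀ y ∈ B', x ⊓ y ∈ B')
    (hB'sup : ∀ x ∈ B', ∀ y ∈ B', x ⊔ y ∈ B')
    (hBdist : ∀ x ∈ B, ∀ y ∈ B, ∀ z ∈ B, x ⊓ (y ⊔ z) = (x ⊓ y) ⊔ (x ⊓ z))
    (hB'dist : ∀ x ∈ B', ∀ y ∈ B', ∀ z ∈ B', x ⊓ (y ⊔ z) = (x ⊓ y) ⊔ (x ⊓ z))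
    (hmix : ∀ b ∈ B, ∀ c ∈ B', b ⊓ c ∈ B ∧ b ⊔ c ∈ B') :
    ∀ x y z : L, x ⊓ (y ⊔ z) = (x ⊓ y) ⊔ (x ⊓ z) := by
  have hnot : ∀ a ∈ B, a ∉ B' := fun a ha => (hdisj1 a ha).1
  refine inf_sup_left_of_no_diamond fun p q r o i hpq hqr hrp jpq jqr jrp => ?_
  rcases hcover p with hp | hp | rfl | rfl
  rotate_left 2
  · exact diamond_trivial_of_le hqr jpq jrp bot_le bot_le
  · exact diamond_trivial_of_ge jqr hpq hrp le_top le_top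
  all_goals rcases hcover q with hq | hq | rfl | rfl
  any_goals first
    | exact diamond_trivial_of_le hrp jqr jpq bot_le bot_le
    | exact diamond_trivial_of_ge jrp hqr hpq le_top le_top
  all_goals rcases hcover r with hr | hr | rfl | rfl
  any_goals first
    | exact diamond_trivial_of_le hpq jrp jqr bot_le bot_le
    | exact diamond_trivial_of_ge jpq hrp hqr le_top le_top
  · exact diamond_trivial_of_distrib hpq hqr hrp jpq jqr jrp (hBdist p hp q hq r hr)
  all_goals try exact diamond_trivial_of_distrib hpq hqr hrp jpq jqr jrp (hB'dist p hp q hq r hr)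
  all_goals exfalso
  · exact hnot i (jpq ▸ hBsup p hp q hq) (jqr ▸ (hmix q hq r hr).2)
  · exact hnot i (jrp ▸ hBsup r hr p hp) (jpq ▸ (hmix p hp q hq).2)
  · exact hnot o (hpq ▸ (hmix p hp q hq).1) (hqr ▸ hB'inf q hq r hr)
  · exact hnot i (jqr ▸ hBsup q hq r hr) (jrp ▸ (hmix r hr p hp).2)
  · exact hnot o (hqr ▸ (hmix q hq r hr).1) (hrp ▸ hB'inf r hr p hp)
  · exact hnot o (hrp ▸ (hmix r hr p hp).1) (hpq ▸ hB'inf p hp q hq)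
end

section
/- Let B be a square-increasing commutative residuated lattice and let c ∈ B be the greatest strict lower bound of e, i.e., c < e and x ≤ c for every x < e (this holds when B is subdirectly irreducible). Then c·c = c, e ≤ c → e, and c → c = c → e. Moreover: (a) if c → e = e, then the set {c, e} is closed under ·, →, ∧ and ∨ (so it is a subalgebra isomorphic to the two-element Boolean residuated lattice); (b) if c → e ≠ e, then e < c → e, (c → e) → e = c, c·(c → e) = c, (c → e)·(c → e) = c → e, and the three-element chain {c, e, c → e} is closed under ·, →, ∧ and ∨ (so it is a subalgebra isomorphic to the residuated-lattice reduct of the three-element Sugihara monoid). -/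
namespace CRL

variable {B : Type*} [CRL B]

theorem mul_le_mul_left_of_le {x y : B} (h : x ≤ y) (z : B) : z * x ≤ z * y :=
  (residuation z x (z * y)).2 (h.trans ((residuation z y (z * y)).1 le_rfl))

theorem mul_resid_le_s13 (x z : B) : x * resid x z ≤ z :=
  (residuation x _ z).2 le_rfl

theorem le_resid {x y z : B} (h : x * y ≤ z) : y ≤ resid x z :=
  (residuation x y z).1 h

theorem one_resid (x : B) : resid 1 x = x :=
  le_antisymm (by simpa using mul_resid_le_s13 1 x) (le_resid (by simp))

theorem resid_mono_right (x : B) {y z : B} (h : y ≤ z) : resid x y ≤ resid x z :=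
  le_resid ((mul_resid_le_s13 x y).trans h)

theorem resid_anti_left {x y : B} (h : x ≤ y) (z : B) : resid y z ≤ resid x z :=
  le_resid <| by
    rw [mul_comm]
    exact (mul_le_mul_left_of_le h _).trans (mul_comm y (resid y z) ▸ mul_resid_le_s13 y z)

end CRL

/-- Let `B` be a square-increasing commutative residuated
lattice and `c` the greatest strict lower bound of `e`.  Then `c·c = c`,
`e ≤ c → e` and `c → c = c → e`.  Moreover: (a) if `c → e = e` then `{c, e}` is
closed under `·`, `→`, `∧`, `∨`; (b) if `c → e ≠ e` then `e < c → e`,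
`(c → e) → e = c`, `c·(c → e) = c`, `(c → e)·(c → e) = c → e`, and the chain
`{c, e, c → e}` is closed under `·`, `→`, `∧`, `∨`. -/
theorem stmt13 {B : Type*} [CRL B]
    (sq : ∀ x : B, x ≤ x * x)
    (c : B) (hc1 : c < 1) (hc2 : ∀ x : B, x < 1 → x ≤ c) :
    c * c = c ∧ (1 : B) ≤ CRL.resid c 1 ∧ CRL.resid c c = CRL.resid c 1 ∧
    (CRL.resid c 1 = 1 →
      ∀ x ∈ ({c, 1} : Set B), ∀ y ∈ ({c, 1} : Set B),
        x * y ∈ ({c, 1} : Set B) ∧ CRL.resid x y ∈ ({c, 1} : Set B) ∧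
        x ⊓ y ∈ ({c, 1} : Set B) ∧ x ⊔ y ∈ ({c, 1} : Set B)) ∧
    (CRL.resid c 1 ≠ 1 →
      (1 : B) < CRL.resid c 1 ∧ CRL.resid (CRL.resid c 1) 1 = c ∧
      c * CRL.resid c 1 = c ∧ CRL.resid c 1 * CRL.resid c 1 = CRL.resid c 1 ∧
      ∀ x ∈ ({c, 1, CRL.resid c 1} : Set B), ∀ y ∈ ({c, 1, CRL.resid c 1} : Set B),
        x * y ∈ ({c, 1, CRL.resid c 1} : Set B) ∧
        CRL.resid x y ∈ ({c, 1, CRL.resid c 1} : Set B) ∧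
        x ⊓ y ∈ ({c, 1, CRL.resid c 1} : Set B) ∧
        x ⊔ y ∈ ({c, 1, CRL.resid c 1} : Set B)) := by
  have hcc : c * c = c :=
    le_antisymm (by simpa using CRL.mul_le_mul_left_of_le hc1.le c) (sq c)
  have h1a : (1 : B) ≤ CRL.resid c 1 := CRL.le_resid (by simpa using hc1.le)
  have hca1 := CRL.mul_resid_le_s13 c 1
  have hr1 := CRL.one_resid (B := B)
  have hres : ∀ z : B, CRL.resid (CRL.resid c 1) z ≤ z := fun z =>
    (CRL.resid_anti_left h1a z).trans (hr1 z).le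
  generalize ha : CRL.resid c 1 = a at *
  have hca : c * a = c := by
    apply le_antisymm
    · refine hc2 _ (lt_of_le_of_ne hca1 fun h => hc1.ne ?_)
      calc c = c * (c * a) := by rw [h, mul_one]
        _ = 1 := by rw [← mul_assoc, hcc, h]
    · simpa using CRL.mul_le_mul_left_of_le h1a c
  have hac : a * c = c := by rw [mul_comm, hca]
  have hcca : CRL.resid c c = a :=
    le_antisymm (ha ▸ CRL.resid_mono_right c hc1.le) (CRL.le_resid hca.le)
  have haa : a * a = a := by
    refine le_antisymm ?_ (sq a)
    conv_rhs => rw [← hcca]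
    exact CRL.le_resid (by rw [← mul_assoc, hca, hca])
  refine ⟨hcc, h1a, hcca, ?_, fun hne => ?_⟩
  · rintro rfl
    rintro x (rfl | rfl) y (rfl | rfl) <;>
      simp [hcc, hcca, ha, hr1, hc1.le]
  · have hlt : 1 < a := lt_of_le_of_ne h1a (Ne.symm hne)
    have hra1 : CRL.resid a 1 = c := by
      refine le_antisymm (hc2 _ (lt_of_le_of_ne (hres 1) fun h => ?_))
        (CRL.le_resid (hac.le.trans hc1.le))
      have := CRL.mul_resid_le_s13 a 1
      rw [h, mul_one] at this
      exact hlt.not_ge this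
    have hrac : CRL.resid a c = c := le_antisymm (hres c) (CRL.le_resid hac.le)
    have hraa : CRL.resid a a = a := le_antisymm (hres a) (CRL.le_resid haa.le)
    have hrca : CRL.resid c a = a := by
      refine le_antisymm ?_ (CRL.le_resid (hca.le.trans (hc1.trans hlt).le))
      conv_rhs => rw [← hcca]
      apply CRL.le_resid
      have := CRL.mul_le_mul_left_of_le (CRL.mul_resid_le_s13 c a) c
      rwa [← mul_assoc, hcc, hca] at this
    refine ⟨hlt, hra1, hca, haa, ?_⟩
    have hcla := (hc1.trans hlt).le
    rintro x (rfl | rfl | rfl) y (rfl | rfl | rfl) <;>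
      simp [hcc, hcca, ha, hr1, hc1.le, hca, hac, haa, hra1, hrac, hraa, hrca, h1a, hcla]
end

section
/- Let A be a totally ordered De Morgan monoid such that ¬(f·f) < e, every x < e equals ¬(f·f) (A is simple), and e < f (so C4 is a subalgebra of A). Let a ∈ A satisfy a·a = a and a ∉ {¬(f·f), e, f, f·f}. Then e < a < f, a ≤ ¬a, a·¬a = ¬a, a·f = f·f, ¬a·f = f·f, and either ¬a = a or ¬a·¬a = f·f. -/
namespace IRL

variable {α : Type*} [IRL α]

theorem le_iff_neg_le_neg (x y : α) : x ≤ y ↔ neg y ≤ neg x := by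
  simpa using resid_law x 1 y

theorem mul_neg_le_f_iff (x y : α) : x * neg y ≤ f ↔ x ≤ y := by
  rw [resid_law, neg_f, one_mul, ← le_iff_neg_le_neg]

theorem mul_le_mul_of_le_left {x y : α} (h : x ≤ y) (z : α) : x * z ≤ y * z := by
  have h₁ := (resid_law y z (y * z)).1 le_rfl
  exact (resid_law x z (y * z)).2 (h₁.trans ((le_iff_neg_le_neg x y).1 h))

/-- In a simple totally ordered IRL, `x · ¬y` is the top element unless `x ≤ y`. -/
theorem mul_neg_eq_of_not_le (htotal : ∀ x y : α, x ≤ y ∨ y ≤ x)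
    (hsimple : ∀ x : α, x < 1 → x = neg ((f : α) * f))
    {x y : α} (h : ¬ x ≤ y) : x * neg y = f * f := by
  have h₁ : ¬ x * neg y ≤ f := fun h' => h ((mul_neg_le_f_iff x y).1 h')
  have h₂ : neg (x * neg y) ≤ 1 := by
    have := (le_iff_neg_le_neg _ _).1 ((htotal (x * neg y) f).resolve_left h₁)
    rwa [neg_f] at this
  have h₃ : ¬ 1 ≤ neg (x * neg y) := by
    intro h'
    rw [← neg_f, ← le_iff_neg_le_neg] at h'
    exact h₁ h'
  have h₄ := hsimple _ (lt_of_le_not_ge h₂ h₃)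
  rw [← neg_neg (x * neg y), h₄, neg_neg]

theorem le_f_mul_f (htotal : ∀ x y : α, x ≤ y ∨ y ≤ x)
    (hlt : neg ((f : α) * f) < 1)
    (hsimple : ∀ x : α, x < 1 → x = neg ((f : α) * f)) (x : α) : x ≤ f * f := by
  rw [le_iff_neg_le_neg]
  by_cases h : 1 ≤ neg x
  · exact hlt.le.trans h
  · exact (hsimple _ (lt_of_le_not_ge ((htotal 1 (neg x)).resolve_left h) h)).ge

end IRL

/-- Let `A` be a simple totally ordered De Morgan monoid with
`C4` as a subalgebra (`¬(f·f) < e`, every `x < e` equals `¬(f·f)`, and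
`e < f`), and let `a` be an idempotent element outside `{¬(f·f), e, f, f·f}`.
Then `e < a < f`, `a ≤ ¬a`, `a·¬a = ¬a`, `a·f = f·f`, `¬a·f = f·f`, and either
`¬a = a` or `¬a·¬a = f·f`. -/
theorem stmt14 {A : Type*} [IRL A]
    (sq : ∀ x : A, x ≤ x * x)
    (htotal : ∀ x y : A, x ≤ y ∨ y ≤ x)
    (hlt : IRL.neg ((IRL.f : A) * IRL.f) < 1)
    (hsimple : ∀ x : A, x < 1 → x = IRL.neg ((IRL.f : A) * IRL.f))
    (hef : (1 : A) < IRL.f)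
    (a : A) (ha : a * a = a)
    (hout : a ∉ ({IRL.neg ((IRL.f : A) * IRL.f), 1, IRL.f,
      (IRL.f : A) * IRL.f} : Set A)) :
    1 < a ∧ a < IRL.f ∧ a ≤ IRL.neg a ∧ a * IRL.neg a = IRL.neg a ∧
    a * IRL.f = (IRL.f : A) * IRL.f ∧ IRL.neg a * IRL.f = (IRL.f : A) * IRL.f ∧
    (IRL.neg a = a ∨ IRL.neg a * IRL.neg a = (IRL.f : A) * IRL.f) := by
  simp only [Set.mem_insert_iff, Set.mem_singleton_iff, not_or] at hout
  obtain ⟨ha_bot, ha_one, ha_f, ha_top⟩ := hout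
  have h1a : 1 < a := by
    refine lt_of_le_of_ne ?_ (Ne.symm ha_one)
    by_contra h
    exact ha_bot (hsimple a (lt_of_le_not_ge ((htotal 1 a).resolve_left h) h))
  have haf : a < IRL.f := by
    refine lt_of_le_of_ne ?_ ha_f
    by_contra h
    have hfa := (htotal a IRL.f).resolve_left h
    have h₁ : (IRL.f : A) * IRL.f ≤ a * IRL.f := IRL.mul_le_mul_of_le_left hfa _
    have h₂ : IRL.f * a ≤ a * a := IRL.mul_le_mul_of_le_left hfa _
    rw [mul_comm, ha] at h₂
    exact ha_top (le_antisymm (IRL.le_f_mul_f htotal hlt hsimple a) (h₁.trans h₂))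
  have hana : a ≤ IRL.neg a := by
    rw [← IRL.mul_neg_le_f_iff, IRL.neg_neg, ha]
    exact haf.le
  have mul_f : ∀ x : A, 1 < x → x * IRL.f = IRL.f * IRL.f := fun x hx =>
    IRL.mul_neg_eq_of_not_le htotal hsimple hx.not_ge
  refine ⟨h1a, haf, hana, le_antisymm ?_ ?_, mul_f a h1a, mul_f _ (h1a.trans_le hana), ?_⟩
  · rw [mul_comm, ← IRL.resid_law, ha]
  · simpa using IRL.mul_le_mul_of_le_left h1a.le (IRL.neg a)
  · by_cases h : IRL.neg a ≤ a
    · exact Or.inl (le_antisymm h hana)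
    · exact Or.inr (IRL.mul_neg_eq_of_not_le htotal hsimple h)
end

section
/- Let A be a finite totally ordered De Morgan monoid such that ¬(f·f) < e, every x < e equals ¬(f·f) (A is simple), e < f, there exists an element of A outside {¬(f·f), e, f, f·f} (C4 is a proper subalgebra), and every a ∈ A with a·a = a lies in {¬(f·f), e, f, f·f}. Let c ∈ A satisfy e < c and c ≤ x for every x with e < x (c is the cover of e), and let n be a positive integer such that c^{n+1} = c^{n+2} while c^{m+1} ≠ c^{m+2} for every positive integer m < n. Then: (i) c^n = f and c^{n+1} = f·f; (ii) for every positive integer m < n, ¬(c^{m+1}) < c^{n−m} and c^{n−m} ≤ ¬(c^m); (iii) every b ∈ A with b ≠ f·f and b ≠ ¬(f·f) satisfies b·¬b = f. -/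
namespace IRL

variable {α : Type*} [IRL α]

theorem le_neg_iff_mul_le_f (x y : α) : x ≤ neg y ↔ x * y ≤ f := by
  have h := resid_law y x (f : α)
  rw [f, neg_neg, one_mul, mul_comm] at h
  exact h.symm

theorem neg_lt_neg_iff (x y : α) : neg y < neg x ↔ x < y := by
  rw [lt_iff_le_not_ge, lt_iff_le_not_ge, neg_le_neg_iff, neg_le_neg_iff]

theorem mul_le_iff_le_neg (x y z : α) : x * y ≤ z ↔ x ≤ neg (neg z * y) := by
  rw [resid_law, le_neg_iff_mul_le_f, le_neg_iff_mul_le_f, mul_comm]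

theorem mul_mono_left {a b : α} (h : a ≤ b) (y : α) : a * y ≤ b * y :=
  (mul_le_iff_le_neg _ _ _).2 (h.trans ((mul_le_iff_le_neg _ _ _).1 le_rfl))

theorem mul_neg_le_f (b : α) : b * neg b ≤ f := by
  rw [← le_neg_iff_mul_le_f, neg_neg]

theorem pow_mul_le {c b : α} (h : c * b ≤ b) (k : ℕ) : c ^ k * b ≤ b := by
  induction k with
  | zero => simp
  | succ k ih =>
    calc c ^ (k + 1) * b = c ^ k * b * c := by rw [pow_succ]; ac_rfl
      _ ≤ b * c := mul_mono_left ih c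
      _ = c * b := mul_comm _ _
      _ ≤ b := h

theorem le_pow_succ {c : α} (h : 1 ≤ c) (k : ℕ) : c ≤ c ^ (k + 1) := by
  induction k with
  | zero => simp
  | succ k ih =>
    calc c ≤ c ^ (k + 1) := ih
      _ = 1 * c ^ (k + 1) := (one_mul _).symm
      _ ≤ c * c ^ (k + 1) := mul_mono_left h _
      _ = c ^ (k + 1 + 1) := (pow_succ' c (k + 1)).symm

theorem pow_add_eq_of_stable {c : α} {n : ℕ} (h : c ^ n = c ^ (n + 1)) (k : ℕ) :
    c ^ (n + k) = c ^ n := by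
  induction k with
  | zero => rfl
  | succ k ih => rw [← add_assoc, pow_succ, ih, ← pow_succ, ← h]

end IRL

/-- Let `A` be a finite simple totally ordered De Morgan monoid
having `C4 = {¬(f·f), e, f, f·f}` as a proper subalgebra, all of whose
idempotents lie in `C4`.  Let `c` be the cover of `e` and `n` the least
positive integer with `c^(n+1) = c^(n+2)`.  Then (i) `c^n = f` and
`c^(n+1) = f·f`; (ii) `¬(c^(m+1)) < c^(n-m) ≤ ¬(c^m)` for `0 < m < n`;
(iii) `b·¬b = f` for every `b ∉ {f·f, ¬(f·f)}`. -/
theorem stmt15 {A : Type*} [IRL A] [Fintype A]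
    (sq : ∀ x : A, x ≤ x * x)
    (htotal : ∀ x y : A, x ≤ y ∨ y ≤ x)
    (hlt : IRL.neg ((IRL.f : A) * IRL.f) < 1)
    (hsimple : ∀ x : A, x < 1 → x = IRL.neg ((IRL.f : A) * IRL.f))
    (hef : (1 : A) < IRL.f)
    (hproper : ∃ a : A, a ∉ ({IRL.neg ((IRL.f : A) * IRL.f), 1, IRL.f,
      (IRL.f : A) * IRL.f} : Set A))
    (hidem : ∀ a : A, a * a = a → a ∈ ({IRL.neg ((IRL.f : A) * IRL.f), 1, IRL.f,
      (IRL.f : A) * IRL.f} : Set A))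
    (c : A) (hc1 : 1 < c) (hc2 : ∀ x : A, 1 < x → c ≤ x)
    (n : ℕ) (hn : 0 < n)
    (hstab : c ^ (n + 1) = c ^ (n + 2))
    (hminimal : ∀ m : ℕ, 0 < m → m < n → c ^ (m + 1) ≠ c ^ (m + 2)) :
    c ^ n = IRL.f ∧ c ^ (n + 1) = (IRL.f : A) * IRL.f ∧
    (∀ m : ℕ, 0 < m → m < n →
      IRL.neg (c ^ (m + 1)) < c ^ (n - m) ∧ c ^ (n - m) ≤ IRL.neg (c ^ m)) ∧
    (∀ b : A, b ≠ (IRL.f : A) * IRL.f → b ≠ IRL.neg ((IRL.f : A) * IRL.f) →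
      b * IRL.neg b = IRL.f) := by
  have f_lt : (IRL.f : A) < IRL.f * IRL.f := by
    rw [← IRL.neg_lt_neg_iff]
    simpa only [IRL.f, IRL.neg_neg] using hlt
  have le_f_of_ne : ∀ x : A, x ≠ IRL.f * IRL.f → x ≤ IRL.f := by
    intro x hx
    rcases htotal x IRL.f with h | h
    · exact h
    by_contra hxf
    have h1 : IRL.neg x < 1 := by
      have := (IRL.neg_lt_neg_iff IRL.f x).2 (lt_of_le_not_ge h hxf)
      simpa only [IRL.f, IRL.neg_neg] using this
    apply hx
    rw [← IRL.neg_neg x, hsimple _ h1, IRL.neg_neg]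
  have eq_f : ∀ x : A, x ≤ IRL.f → ¬ c ≤ IRL.neg x → x = IRL.f := by
    intro x hx hcx
    by_contra hne
    apply hcx
    apply hc2
    have := (IRL.neg_lt_neg_iff x IRL.f).2 (lt_of_le_of_ne hx hne)
    simpa only [IRL.f, IRL.neg_neg] using this
  have one_le_of_ne : ∀ x : A, x ≠ IRL.neg (IRL.f * IRL.f) → 1 ≤ x := by
    intro x hx
    rcases htotal 1 x with h | h
    · exact h
    by_contra hx1
    exact hx (hsimple x (lt_of_le_not_ge h hx1))
  have htop : c ^ (n + 1) = (IRL.f : A) * IRL.f := by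
    have hid : c ^ (n + 1) * c ^ (n + 1) = c ^ (n + 1) := by
      rw [← pow_add, IRL.pow_add_eq_of_stable hstab]
    have hgt : 1 < c ^ (n + 1) := hc1.trans_le (IRL.le_pow_succ hc1.le n)
    rcases hidem _ hid with h | h | h | h
    · exact absurd (h ▸ hgt) hlt.asymm
    · exact absurd h hgt.ne'
    · rw [h] at hid
      exact absurd hid f_lt.ne'
    · exact h
  have not_le : ¬ c ^ (n + 1) ≤ IRL.f := by
    rw [htop]
    exact f_lt.not_ge
  have pow_n : c ^ n = IRL.f := by
    apply eq_f
    · rcases Nat.lt_or_ge 1 n with h | h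
      · apply le_f_of_ne
        rw [← htop]
        have := hminimal (n - 1) (by omega) (by omega)
        rwa [show n - 1 + 1 = n by omega, show n - 1 + 2 = n + 1 by omega] at this
      · rw [show n = 1 by omega, pow_one]
        exact hc2 _ hef
    · rwa [IRL.le_neg_iff_mul_le_f, ← pow_succ']
  refine ⟨pow_n, htop, fun m _ hmn => ⟨?_, ?_⟩, fun b hb hb' => ?_⟩
  · have h : ¬ c ^ (n - m) ≤ IRL.neg (c ^ (m + 1)) := by
      rwa [IRL.le_neg_iff_mul_le_f, ← pow_add, show n - m + (m + 1) = n + 1 by omega]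
    exact lt_of_le_not_ge ((htotal _ _).resolve_right h) h
  · rw [IRL.le_neg_iff_mul_le_f, ← pow_add, Nat.sub_add_cancel hmn.le, pow_n]
  · refine eq_f _ (IRL.mul_neg_le_f b) fun h => hb ?_
    rw [mul_comm, ← IRL.mul_le_iff_le_neg] at h
    have h1 : c ^ (n + 1) ≤ b := by
      calc c ^ (n + 1) = 1 * c ^ (n + 1) := (one_mul _).symm
        _ ≤ b * c ^ (n + 1) := IRL.mul_mono_left (one_le_of_ne b hb') _
        _ = c ^ (n + 1) * b := mul_comm _ _
        _ ≤ b := IRL.pow_mul_le h _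
    by_contra hne
    exact not_le (h1.trans (le_f_of_ne b hne))
end

section
/- Let A be a finite totally ordered De Morgan monoid such that ¬(f·f) < e, every x < e equals ¬(f·f) (A is simple), e < f, the set K := {¬(f·f), e, f, f·f} is a proper subset of A, and every subset S ⊆ A with e ∈ S that is closed under ·, ∧, ∨ and ¬ equals A or K (i.e., C4 is the only proper subalgebra of A, so that the variety generated by A covers that generated by C4). Then the cardinality of A is 5 or is even. -/
namespace IRL

variable {α : Type*} [IRL α]

theorem neg_injective : Function.Injective (neg : α → α) :=
  Function.LeftInverse.injective neg_neg

theorem mul_le_f_iff (x y : α) : x * y ≤ f ↔ y ≤ neg x := by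
  rw [resid_law, neg_f, one_mul]

theorem f_mul_le_f_iff (x : α) : f * x ≤ f ↔ x ≤ 1 := by
  rw [mul_le_f_iff, neg_f]

end IRL

open Classical in
/-- A finite type with a fixed-point-free involution has even cardinality. -/
theorem even_card_of_involutive_of_ne {α : Type*} [Fintype α] (g : α → α)
    (hg : Function.Involutive g) (hne : ∀ x, g x ≠ x) : Even (Fintype.card α) := by
  have h : ∑ _x : α, (1 : ZMod 2) = 0 :=
    Finset.sum_involution (fun x _ ↦ g x) (fun _ _ ↦ by decide) (fun x _ _ ↦ hne x)
      (fun x _ ↦ Finset.mem_univ _) (fun x _ ↦ hg x)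
  rw [← ZMod.natCast_eq_zero_iff_even]
  simpa using h

/-- Let `A` be a finite simple totally ordered De Morgan monoid
in which `K = {¬(f·f), e, f, f·f}` (a copy of `C4`) is a proper subset and is
the only proper subalgebra.  Then `|A|` is `5` or even. -/
theorem stmt16 {A : Type*} [IRL A] [Fintype A]
    (sq : ∀ x : A, x ≤ x * x)
    (htotal : ∀ x y : A, x ≤ y ∨ y ≤ x)
    (hlt : IRL.neg ((IRL.f : A) * IRL.f) < 1)
    (hsimple : ∀ x : A, x < 1 → x = IRL.neg ((IRL.f : A) * IRL.f))
    (hef : (1 : A) < IRL.f)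
    (hproper : ({IRL.neg ((IRL.f : A) * IRL.f), 1, IRL.f,
      (IRL.f : A) * IRL.f} : Set A) ≠ Set.univ)
    (honly : ∀ S : Set A, 1 ∈ S →
      (∀ x ∈ S, ∀ y ∈ S, x * y ∈ S) →
      (∀ x ∈ S, ∀ y ∈ S, x ⊓ y ∈ S) →
      (∀ x ∈ S, ∀ y ∈ S, x ⊔ y ∈ S) →
      (∀ x ∈ S, IRL.neg x ∈ S) →
      S = Set.univ ∨ S = ({IRL.neg ((IRL.f : A) * IRL.f), 1, IRL.f,
        (IRL.f : A) * IRL.f} : Set A)) :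
    Fintype.card A = 5 ∨ Even (Fintype.card A) := by
  rcases forall_or_exists_not (fun x : A ↦ IRL.neg x ≠ x) with hne | ⟨a, ha⟩
  · exact Or.inr (even_card_of_involutive_of_ne IRL.neg IRL.neg_neg hne)
  left
  rw [not_not] at ha
  set K : Set A := {IRL.neg ((IRL.f : A) * IRL.f), 1, IRL.f, (IRL.f : A) * IRL.f} with hK
  set z : A := IRL.neg ((IRL.f : A) * IRL.f) with hz
  set t : A := (IRL.f : A) * IRL.f with ht
  have neg_t : IRL.neg t = z := rfl
  have neg_z : IRL.neg z = t := IRL.neg_neg t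
  have z_le (x : A) : z ≤ x := by
    rcases htotal z x with h | h
    · exact h
    · exact (hsimple x (h.trans_lt hlt)).ge
  have le_t (x : A) : x ≤ t := (IRL.neg_le_neg_iff x t).1 (z_le _)
  have eq_z_or (x : A) : x = z ∨ 1 ≤ x := by
    by_cases h : 1 ≤ x
    · exact Or.inr h
    · exact Or.inl (hsimple x (((htotal 1 x).resolve_left h).lt_of_not_ge h))
  have eq_t_or (x : A) : x = t ∨ x ≤ IRL.f := by
    rcases eq_z_or (IRL.neg x) with h | h
    · exact Or.inl (IRL.neg_injective h)
    · rw [← IRL.neg_f, IRL.neg_le_neg_iff] at h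
      exact Or.inr h
  have z_mul (x : A) : z * x = z := by
    refine le_antisymm ((IRL.resid_law _ _ _).2 ?_) (z_le _)
    rw [neg_z]
    exact le_t _
  have t_mul {x : A} (hx : 1 ≤ x) : t * x = t := by
    refine le_antisymm (le_t _) ?_
    simpa [mul_comm] using IRL.mul_le_mul_of_le_left hx t
  have f_mul {x : A} (hx : 1 ≤ x) : IRL.f * x = IRL.f ∨ IRL.f * x = t := by
    rcases eq_t_or (IRL.f * x) with h | h
    · exact Or.inr h
    · have : x = 1 := le_antisymm ((IRL.f_mul_le_f_iff x).1 h) hx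
      simp [this]
  have generated (M : Set A) (h1 : ∀ x ∈ M, 1 ≤ x)
      (hmul : ∀ x ∈ M, ∀ y ∈ M, x * y ∈ M ∪ K) (hneg : ∀ x ∈ M, IRL.neg x ∈ M) :
      M ∪ K = Set.univ ∨ M ∪ K = K := by
    have hKmul : ∀ x ∈ K, ∀ y ∈ M ∪ K, x * y ∈ M ∪ K := by
      intro x hx y hy
      have hy' : y = z ∨ 1 ≤ y := eq_z_or y
      rcases hx with rfl | rfl | rfl | rfl
      · rw [z_mul]; exact Or.inr (by simp [hK])
      · rwa [one_mul]
      · rcases hy' with rfl | h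
        · rw [mul_comm, z_mul]; exact Or.inr (by simp [hK])
        · rcases f_mul h with h | h <;> rw [h] <;> exact Or.inr (by simp [hK])
      · rcases hy' with rfl | h
        · rw [mul_comm, z_mul]; exact Or.inr (by simp [hK])
        · rw [t_mul h]; exact Or.inr (by simp [hK])
    refine honly _ (Or.inr (by simp [hK])) ?_ ?_ ?_ ?_
    · intro x hx y hy
      rcases hx with hx | hx
      · rcases hy with hy | hy
        · exact hmul x hx y hy
        · rw [mul_comm]; exact hKmul y hy x (Or.inl hx)
      · exact hKmul x hx y hy
    · intro x hx y hy
      rcases htotal x y with h | h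
      · rwa [inf_eq_left.2 h]
      · rwa [inf_eq_right.2 h]
    · intro x hx y hy
      rcases htotal x y with h | h
      · rwa [sup_eq_right.2 h]
      · rwa [sup_eq_left.2 h]
    · rintro x (hx | rfl | rfl | rfl | rfl)
      · exact Or.inl (hneg x hx)
      · rw [neg_z]; exact Or.inr (by simp [hK])
      · exact Or.inr (by simp [hK, IRL.f])
      · rw [IRL.neg_f]; exact Or.inr (by simp [hK])
      · rw [neg_t]; exact Or.inr (by simp [hK])
  have hzf : z < IRL.f := hlt.trans hef
  have hft : (IRL.f : A) < t := by
    refine lt_of_le_not_ge (sq _) fun h ↦ ?_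
    exact hef.not_ge ((IRL.f_mul_le_f_iff _).1 h)
  have haK : a ∉ K := by
    rintro (rfl | rfl | rfl | rfl)
    · exact (hzf.trans hft).ne (ha.symm.trans neg_z)
    · exact hef.ne ha.symm
    · exact hef.ne (IRL.neg_f.symm.trans ha)
    · exact (hzf.trans hft).ne (neg_t.symm.trans ha)
  have h1a : 1 ≤ a := (eq_z_or a).resolve_left fun h ↦ haK (by simp [hK, h])
  have haa : a * a ≤ IRL.f := by rw [IRL.mul_le_f_iff, ha]
  have card_of (h : a * a ∈ ({a} : Set A) ∪ K) : Fintype.card A = 5 := by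
    rcases generated {a} (by simpa using h1a) (by simpa using h) (by simpa using ha) with h | h
    · have hu : (Finset.univ : Finset A).val = ({a, z, 1, IRL.f, t} : Multiset A) := by
        rw [Multiset.Nodup.ext Finset.univ.nodup]
        · intro x
          have := h.ge (Set.mem_univ x)
          simpa [hK, or_comm, or_left_comm, or_assoc] using this
        · simp only [hK, Set.mem_insert_iff, Set.mem_singleton_iff] at haK
          simp [haK, hlt.ne, hzf.ne, (hzf.trans hft).ne, hef.ne, (hef.trans hft).ne, hft.ne]
      rw [Fintype.card, Finset.card, hu]
      rfl
    · exact absurd (h.le (Or.inl rfl)) haK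
  apply card_of
  set b := a * a with hb
  set c := IRL.neg b with hc
  have neg_c : IRL.neg c = b := IRL.neg_neg b
  have h1c : 1 ≤ c := by rw [← IRL.neg_f]; exact (IRL.neg_le_neg_iff _ _).2 haa
  have hab : a ≤ b := sq a
  have hca : c * a = a := by
    refine le_antisymm ?_ (by simpa using IRL.mul_le_mul_of_le_left h1c a)
    rw [IRL.resid_law, ha, neg_c]
  have hcb : c * b = b := by rw [hb, ← mul_assoc, hca]
  have hcc : c * c = c := by
    refine le_antisymm ?_ (sq c)
    rw [IRL.resid_law, neg_c, mul_comm, hcb]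
  have hbb : b * b = b ∨ b * b = t := by
    rcases eq_t_or (b * b) with h | h
    · exact Or.inr h
    · have hba : b ≤ a := by
        refine ((IRL.mul_le_f_iff _ _).1 h).trans ?_
        exact ((IRL.neg_le_neg_iff a b).2 hab).trans ha.le
      have : b = a := le_antisymm hba hab
      left
      rw [this, ← hb, this]
  have := generated {c, b} (by simp [h1c, h1a.trans hab]) (by
    rintro x (rfl | rfl) y (rfl | rfl)
    · simp [hcc]
    · simp [hcb]
    · simp [mul_comm _ c, hcb]
    · rcases hbb with h | h <;> simp [h, hK]) (by
    rintro x (rfl | rfl)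
    · simp [neg_c]
    · simp [hc])
  rcases this with h | h
  · rcases h.ge (Set.mem_univ a) with (h | h) | h
    · exact Or.inl (by rw [← neg_c, ← h, ha]; rfl)
    · exact Or.inl h.symm
    · exact absurd h haK
  · exact Or.inr (h.le (by simp))
end
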